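/- Let ν > 0, β > 0 and γ ∈ ℝ. Then ∫₀^∞ x^{ν−1}·exp(−βx² − γx) dx = (1/2)·β^{−ν/2}·Γ(ν/2)·₁F₁(ν/2; 1/2; γ²/(4β)) − (γ/2)·β^{−(ν+1)/2}·Γ((ν+1)/2)·₁F₁((ν+1)/2; 3/2; γ²/(4β)). (This is the integral identity underlying the closed-form expectation in the constructive-interference rate analysis.) -/

import Mathlib

open MeasureTheory Real

/-- The confluent hypergeometric series `₁F₁(a; b; z) = ∑ₘ ((a)ₘ/(b)ₘ) zᵐ/m!`, where
`(x)ₘ` is the ascending Pochhammer symbol. -/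
noncomputable def oneFOne (a b z : ℝ) : ℝ :=
  ∑' m : ℕ,
    (Polynomial.eval a (ascPochhammer ℝ m) / Polynomial.eval b (ascPochhammer ℝ m)) *
      z ^ m / (Nat.factorial m : ℝ)

/-- `Γ(s + m) = Γ(s) (s)ₘ` for `s > 0`. -/
theorem Gamma_add_nat_eq_mul_ascPochhammer {s : ℝ} (hs : 0 < s) (m : ℕ) :
    Real.Gamma (s + m) = Real.Gamma s * (ascPochhammer ℝ m).eval s := by
  induction m with
  | zero => simp
  | succ m ih =>
    rw [Nat.cast_succ, ← add_assoc, Real.Gamma_add_one (by positivity), ih,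
      ascPochhammer_succ_eval]
    ring

theorem factorial_two_mul_eq_ascPochhammer (m : ℕ) :
    ((2 * m).factorial : ℝ) = 4 ^ m * m.factorial * (ascPochhammer ℝ m).eval (1 / 2) := by
  induction m with
  | zero => simp
  | succ m ih =>
    rw [show 2 * (m + 1) = 2 * m + 1 + 1 by ring, Nat.factorial_succ, Nat.factorial_succ,
      Nat.factorial_succ m, ascPochhammer_succ_eval]
    push_cast
    rw [ih]
    ring

theorem factorial_two_mul_add_one_eq_ascPochhammer (m : ℕ) :
    ((2 * m + 1).factorial : ℝ) = 4 ^ m * m.factorial * (ascPochhammer ℝ m).eval (3 / 2) := by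
  induction m with
  | zero => simp
  | succ m ih =>
    rw [show 2 * (m + 1) + 1 = 2 * m + 1 + 1 + 1 by ring, Nat.factorial_succ, Nat.factorial_succ,
      Nat.factorial_succ m, ascPochhammer_succ_eval]
    push_cast
    rw [ih]
    ring

theorem integrableOn_rpow_mul_exp_quadratic {ν β : ℝ} (hν : 0 < ν) (hβ : 0 < β) (c : ℝ) :
    IntegrableOn (fun x : ℝ => x ^ (ν - 1) * Real.exp (-β * x ^ 2 + c * x)) (Set.Ioi 0) := by
  have h := (integrableOn_rpow_mul_exp_neg_mul_sq (half_pos hβ)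
    (show -1 < ν - 1 by linarith)).const_mul (Real.exp (c ^ 2 / (2 * β)))
  refine Integrable.mono' h (by fun_prop) ?_
  refine (ae_restrict_iff' measurableSet_Ioi).2 (.of_forall fun x hx => ?_)
  have hx : 0 < x := hx
  rw [Real.norm_of_nonneg (by positivity), mul_left_comm, ← Real.exp_add]
  refine mul_le_mul_of_nonneg_left (Real.exp_le_exp.2 ?_) (by positivity)
  have : c ^ 2 / (2 * β) + -(β / 2) * x ^ 2 - (-β * x ^ 2 + c * x)
      = (β * x - c) ^ 2 / (2 * β) := by
    field_simp
    ring
  have : 0 ≤ (β * x - c) ^ 2 / (2 * β) := by positivity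
  linarith

theorem integral_rpow_mul_exp_neg_mul_sq_mul_pow {ν β : ℝ} (hν : 0 < ν) (hβ : 0 < β) (c : ℝ)
    (n : ℕ) :
    ∫ x in Set.Ioi (0 : ℝ), x ^ (ν - 1) * Real.exp (-β * x ^ 2) * ((c * x) ^ n / n.factorial)
      = c ^ n / n.factorial * (β ^ (-((ν + n) / 2)) * (1 / 2) * Real.Gamma ((ν + n) / 2)) := by
  have hn : (0 : ℝ) ≤ n := n.cast_nonneg
  have h := integral_rpow_mul_exp_neg_mul_rpow (p := 2) (q := ν + n - 1) two_pos
    (by linarith) hβ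
  rw [sub_add_cancel, neg_div] at h
  rw [← h, ← integral_const_mul]
  refine setIntegral_congr_fun measurableSet_Ioi fun x hx => ?_
  have hx : 0 < x := hx
  rw [show ν + n - 1 = ν - 1 + n by ring, Real.rpow_add hx, Real.rpow_natCast, Real.rpow_two,
    mul_pow]
  ring

/-- Expanding `exp (c * x)` and integrating term by term. -/
theorem hasSum_integral_rpow_mul_exp_quadratic {ν β : ℝ} (hν : 0 < ν) (hβ : 0 < β) (c : ℝ) :
    HasSum (fun n : ℕ =>
        c ^ n / n.factorial * (β ^ (-((ν + n) / 2)) * (1 / 2) * Real.Gamma ((ν + n) / 2)))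
      (∫ x in Set.Ioi (0 : ℝ), x ^ (ν - 1) * Real.exp (-β * x ^ 2 + c * x)) := by
  have hexp (a x : ℝ) : HasSum
      (fun n : ℕ => x ^ (ν - 1) * Real.exp (-β * x ^ 2) * ((a * x) ^ n / n.factorial))
      (x ^ (ν - 1) * Real.exp (-β * x ^ 2 + a * x)) := by
    rw [Real.exp_add, ← mul_assoc, Real.exp_eq_exp_ℝ]
    exact (NormedSpace.expSeries_div_hasSum_exp (a * x)).mul_left _
  simp_rw [← integral_rpow_mul_exp_neg_mul_sq_mul_pow hν hβ c]
  refine hasSum_integral_of_dominated_convergence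
    (fun n x => x ^ (ν - 1) * Real.exp (-β * x ^ 2) * ((|c| * x) ^ n / n.factorial))
    (fun n => by fun_prop) (fun n => ?_) (.of_forall fun x => (hexp |c| x).summable) ?_
    (.of_forall fun x => hexp c x)
  · refine (ae_restrict_iff' measurableSet_Ioi).2 (.of_forall fun x hx => ?_)
    have hx : 0 < x := hx
    rw [norm_mul, Real.norm_of_nonneg (by positivity), norm_div, norm_pow, norm_mul,
      Real.norm_eq_abs c, Real.norm_of_nonneg hx.le, Real.norm_natCast]
  · simp_rw [fun x => (hexp |c| x).tsum_eq]
    exact integrableOn_rpow_mul_exp_quadratic hν hβ |c|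

/-- For `ν > 0`, `β > 0` and `γ ∈ ℝ`,
`∫₀^∞ x^(ν−1) exp(−βx² − γx) dx
  = (1/2) β^(−ν/2) Γ(ν/2) ₁F₁(ν/2; 1/2; γ²/(4β))
    − (γ/2) β^(−(ν+1)/2) Γ((ν+1)/2) ₁F₁((ν+1)/2; 3/2; γ²/(4β))`. -/
theorem integral_rpow_exp_quadratic (ν β γ : ℝ) (hν : 0 < ν) (hβ : 0 < β) :
    (∫ x in Set.Ioi (0 : ℝ), x ^ (ν - 1) * Real.exp (-β * x ^ 2 - γ * x))
      = (1 / 2) * β ^ (-(ν / 2)) * Real.Gamma (ν / 2) *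
          oneFOne (ν / 2) (1 / 2) (γ ^ 2 / (4 * β))
        - (γ / 2) * β ^ (-((ν + 1) / 2)) * Real.Gamma ((ν + 1) / 2) *
          oneFOne ((ν + 1) / 2) (3 / 2) (γ ^ 2 / (4 * β)) := by
  have hI : (∫ x in Set.Ioi (0 : ℝ), x ^ (ν - 1) * Real.exp (-β * x ^ 2 - γ * x))
      = ∫ x in Set.Ioi (0 : ℝ), x ^ (ν - 1) * Real.exp (-β * x ^ 2 + -γ * x) := by
    simp only [neg_mul, sub_eq_add_neg]
  have hS := hasSum_integral_rpow_mul_exp_quadratic hν hβ (-γ)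
  rw [← hI] at hS
  have hβm (s : ℝ) (m : ℕ) : β ^ (-(s + m)) = β ^ (-s) / β ^ m := by
    rw [neg_add, ← sub_eq_add_neg, Real.rpow_sub_natCast hβ.ne']
  generalize (∫ x in Set.Ioi (0 : ℝ), x ^ (ν - 1) * Real.exp (-β * x ^ 2 - γ * x)) = I at hS ⊢
  rw [sub_eq_add_neg, ← neg_mul, oneFOne, oneFOne, ← tsum_mul_left, ← tsum_mul_left]
  generalize hf : (fun n : ℕ => (-γ) ^ n / n.factorial *
    (β ^ (-((ν + n) / 2)) * (1 / 2) * Real.Gamma ((ν + n) / 2))) = f at hS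
  have he : Summable fun m => f (2 * m) :=
    hS.summable.comp_injective (mul_right_injective₀ two_ne_zero)
  have ho : Summable fun m => f (2 * m + 1) :=
    hS.summable.comp_injective
      ((add_left_injective 1).comp (mul_right_injective₀ two_ne_zero))
  rw [← hS.tsum_eq, ← tsum_even_add_odd he ho]
  refine congrArg₂ (· + ·) (tsum_congr fun m => ?_) (tsum_congr fun m => ?_)
  · have hp := ascPochhammer_pos m (1 / 2 : ℝ) (by norm_num)
    rw [← hf]
    beta_reduce
    rw [show (ν + (2 * m : ℕ)) / 2 = ν / 2 + m by push_cast; ring, hβm,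
      Gamma_add_nat_eq_mul_ascPochhammer (by positivity), factorial_two_mul_eq_ascPochhammer,
      pow_mul, neg_sq, div_pow, mul_pow]
    field_simp
  · have hp := ascPochhammer_pos m (3 / 2 : ℝ) (by norm_num)
    rw [← hf]
    beta_reduce
    rw [show (ν + (2 * m + 1 : ℕ)) / 2 = (ν + 1) / 2 + m by push_cast; ring, hβm,
      Gamma_add_nat_eq_mul_ascPochhammer (by positivity),
      factorial_two_mul_add_one_eq_ascPochhammer, pow_succ, pow_mul, neg_sq, div_pow, mul_pow]
    field_simp
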